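/- For t > 7, we have ζ(1/2 + it) = 0 if and only if Re(η(1/2 + it)) = 0, where η(s) = π^(-s/2) Γ(s/2) ζ'(s). -/

import Mathlib

open Complex

noncomputable def zhangEta (s : ℂ) : ℂ :=
  (Real.pi : ℂ) ^ (-s / 2) * Complex.Gamma (s / 2) * deriv riemannZeta s

/-- Reality of the completed zeta function on the critical line. -/
lemma completed_im_zero (u : ℝ) : (completedRiemannZeta (1 / 2 + u * I)).im = 0 := by
  set s : ℂ := 1 / 2 + u * I with hs
  have hre : 0 < s.re := by simp [hs]
  have hs0 : s ≠ 0 := fun h => by simp [h] at hre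
  have hre' : 0 < ((starRingEnd ℂ) s).re := by simpa using hre
  have hs0' : (starRingEnd ℂ) s ≠ 0 := fun h => by simp [h] at hre'
  have hG := Gammaℝ_ne_zero_of_re_pos hre
  have hG' := Gammaℝ_ne_zero_of_re_pos hre'
  have e1 : completedRiemannZeta s = riemannZeta s * Gammaℝ s := by
    rw [riemannZeta_def_of_ne_zero hs0]; field_simp
  have e2 : completedRiemannZeta ((starRingEnd ℂ) s) =
      riemannZeta ((starRingEnd ℂ) s) * Gammaℝ ((starRingEnd ℂ) s) := by
    rw [riemannZeta_def_of_ne_zero hs0']; field_simp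
  have hGc : Gammaℝ ((starRingEnd ℂ) s) = (starRingEnd ℂ) (Gammaℝ s) := by
    have h2 : (starRingEnd ℂ) s / 2 = (starRingEnd ℂ) (s / 2) := by simp [map_ofNat]
    have h3 : -(starRingEnd ℂ) s / 2 = (starRingEnd ℂ) (-s / 2) := by simp [map_ofNat]
    have harg : (Real.pi : ℂ).arg ≠ Real.pi := by
      rw [arg_ofReal_of_nonneg Real.pi_pos.le]; exact Real.pi_pos.ne
    rw [Gammaℝ_def, Gammaℝ_def, h2, h3, Complex.Gamma_conj, map_mul, cpow_conj _ _ harg,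
      conj_ofReal]
  have e3 : (starRingEnd ℂ) s = 1 - s := by
    apply Complex.ext <;> simp [hs]; norm_num
  have key : (starRingEnd ℂ) (completedRiemannZeta s) = completedRiemannZeta s := by
    rw [e1, map_mul, ← riemannZeta_conj, ← hGc, ← e2, e3, completedRiemannZeta_one_sub, e1]
  exact conj_eq_iff_im.mp key

lemma deriv_completed_re_zero (t : ℝ) :
    (deriv completedRiemannZeta (1 / 2 + t * I)).re = 0 := by
  set s : ℂ := 1 / 2 + t * I with hs
  have hre : s.re = 1 / 2 := by simp [hs]
  have hs0 : s ≠ 0 := fun h => by simp [h] at hre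
  have hs1 : s ≠ 1 := fun h => by norm_num [h] at hre
  have h1 := (differentiableAt_completedZeta hs0 hs1).hasDerivAt
  have h2 : HasDerivAt (fun u : ℂ => 1 / 2 + u * I) I (t : ℂ) := by
    simpa using ((hasDerivAt_id (t : ℂ)).mul_const I).const_add (1 / 2)
  have h3 := (HasDerivAt.comp (t : ℂ) (h₂ := completedRiemannZeta) h1 h2).comp_ofReal
  have h4 : HasDerivAt (fun u : ℝ => (completedRiemannZeta (1 / 2 + u * I)).im)
      (deriv completedRiemannZeta s * I).im t :=
    (imCLM.hasFDerivAt.comp_hasDerivAt t h3)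
  have h5 : (fun u : ℝ => (completedRiemannZeta (1 / 2 + u * I)).im) = fun _ => 0 :=
    funext completed_im_zero
  rw [h5] at h4
  have := h4.unique (hasDerivAt_const t (0 : ℝ))
  simpa using this

/-- Logarithm of the modulus of the Euler product approximating `Gamma`. -/
noncomputable def logSeq (y : ℝ) (n : ℕ) (x : ℝ) : ℝ :=
  x * Real.log n + Real.log n.factorial -
    ∑ j ∈ Finset.range (n + 1), Real.log ((x + j) ^ 2 + y ^ 2) / 2

lemma logSeq_eq (y : ℝ) (hy : 0 < y) (n : ℕ) (hn : 0 < n) (x : ℝ) :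
    Real.log ‖Complex.GammaSeq (x + y * I) n‖ = logSeq y n x := by
  have hn' : (0 : ℝ) < n := by exact_mod_cast hn
  have hterm : ∀ j : ℕ, ‖((x : ℂ) + y * I + j)‖ = Real.sqrt ((x + j) ^ 2 + y ^ 2) := by
    intro j
    have : (x : ℂ) + y * I + j = ((x + j : ℝ) : ℂ) + y * I := by push_cast; ring
    rw [this, Complex.norm_add_mul_I]
  have hpos : ∀ j : ℕ, 0 < (x + j) ^ 2 + y ^ 2 := fun j => by positivity
  have hnp : ‖(n : ℂ) ^ ((x : ℂ) + y * I)‖ = (n : ℝ) ^ x := by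
    rw [Complex.norm_natCast_cpow_of_pos hn]; simp
  have hprod : ∏ j ∈ Finset.range (n + 1), Real.sqrt ((x + j) ^ 2 + y ^ 2) ≠ 0 :=
    Finset.prod_ne_zero_iff.mpr fun j _ => (Real.sqrt_pos.mpr (hpos j)).ne'
  rw [Complex.GammaSeq, norm_div, norm_mul, norm_prod, hnp, Complex.norm_natCast]
  simp_rw [hterm]
  rw [Real.log_div (by positivity) hprod, Real.log_mul (by positivity) (by positivity),
    Real.log_rpow hn', Real.log_prod (fun j _ => (Real.sqrt_pos.mpr (hpos j)).ne'), logSeq]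
  congr 1
  exact Finset.sum_congr rfl fun j _ => Real.log_sqrt (hpos j).le

lemma logSeq_hasDerivAt (y : ℝ) (hy : 0 < y) (n : ℕ) (x : ℝ) :
    HasDerivAt (logSeq y n)
      (Real.log n - ∑ j ∈ Finset.range (n + 1), (x + j) / ((x + j) ^ 2 + y ^ 2)) x := by
  have hsum : HasDerivAt
      (fun x : ℝ => ∑ j ∈ Finset.range (n + 1), Real.log ((x + j) ^ 2 + y ^ 2) / 2)
      (∑ j ∈ Finset.range (n + 1), (x + j) / ((x + j) ^ 2 + y ^ 2)) x := by
    apply HasDerivAt.fun_sum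
    intro j _
    have hpos : 0 < (x + j) ^ 2 + y ^ 2 := by positivity
    have h1 : HasDerivAt (fun x : ℝ => (x + j) ^ 2 + y ^ 2) (2 * (x + j)) x := by
      simpa using (((hasDerivAt_id x).add_const (j : ℝ)).pow 2).add_const (y ^ 2)
    refine ((h1.log hpos.ne').div_const 2).congr_deriv ?_
    field_simp
  have h0 : HasDerivAt (fun x : ℝ => x * Real.log n + Real.log n.factorial) (Real.log n) x := by
    simpa using ((hasDerivAt_id x).mul_const (Real.log n)).add_const (Real.log n.factorial)
  exact h0.sub hsum

lemma term_bound (y : ℝ) (hy : 7 / 2 < y) (u : ℝ) (hu : 0 < u) :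
    u / (u ^ 2 + y ^ 2) ≤
      Real.log ((u + 1 / 2) ^ 2 + 12) / 2 - Real.log ((u - 1 / 2) ^ 2 + 12) / 2 := by
  have hp : 0 < (u - 1 / 2) ^ 2 + 12 := by positivity
  have hq : 0 < (u + 1 / 2) ^ 2 + 12 := by positivity
  have hx : 0 ≤ 2 * u / ((u - 1 / 2) ^ 2 + 12) := by positivity
  have h := Real.le_log_one_add_of_nonneg hx
  have e : 1 + 2 * u / ((u - 1 / 2) ^ 2 + 12) =
      ((u + 1 / 2) ^ 2 + 12) / ((u - 1 / 2) ^ 2 + 12) := by field_simp; ring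
  rw [e, Real.log_div hq.ne' hp.ne'] at h
  have e2 : 2 * (2 * u / ((u - 1 / 2) ^ 2 + 12)) / (2 * u / ((u - 1 / 2) ^ 2 + 12) + 2) =
      2 * (u / (u ^ 2 + 49 / 4)) := by
    have : 0 < 2 * u + 2 * ((u - 1 / 2) ^ 2 + 12) := by positivity
    field_simp
    ring
  rw [e2] at h
  have h3 : u / (u ^ 2 + y ^ 2) ≤ u / (u ^ 2 + 49 / 4) := by
    apply div_le_div_of_nonneg_left hu.le (by positivity)
    nlinarith
  linarith

lemma sum_bound (y : ℝ) (hy : 7 / 2 < y) (x : ℝ) (hx : 0 < x) (n : ℕ) :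
    ∑ j ∈ Finset.range n, (x + j) / ((x + j) ^ 2 + y ^ 2) ≤
      Real.log ((x + n - 1 / 2) ^ 2 + 12) / 2 - Real.log ((x - 1 / 2) ^ 2 + 12) / 2 := by
  induction n with
  | zero => simp
  | succ k ih =>
    rw [Finset.sum_range_succ]
    have := term_bound y hy (x + k) (by positivity)
    have e : x + ((k + 1 : ℕ) : ℝ) - 1 / 2 = x + k + 1 / 2 := by push_cast; ring
    rw [e]
    linarith

noncomputable def lowC (n : ℕ) : ℝ :=
  Real.log 12 / 2 - Real.log ((1 + 2 * (n : ℝ)⁻¹) ^ 2 + 12 * ((n : ℝ)⁻¹) ^ 2) / 2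

lemma deriv_bound (y : ℝ) (hy : 7 / 2 < y) (x : ℝ) (hx : 0 < x) (hx1 : x ≤ 1) (n : ℕ)
    (hn : 0 < n) :
    lowC n ≤ Real.log n - ∑ j ∈ Finset.range (n + 1), (x + j) / ((x + j) ^ 2 + y ^ 2) := by
  have hn' : (0 : ℝ) < n := by exact_mod_cast hn
  have h := sum_bound y hy x hx (n + 1)
  have h1 : Real.log 12 ≤ Real.log ((x - 1 / 2) ^ 2 + 12) :=
    Real.log_le_log (by norm_num) (by nlinarith [sq_nonneg (x - 1 / 2)])
  have h2 : Real.log ((x + ((n + 1 : ℕ) : ℝ) - 1 / 2) ^ 2 + 12) ≤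
      Real.log (((n : ℝ) + 2) ^ 2 + 12) := by
    apply Real.log_le_log (by positivity)
    push_cast
    nlinarith
  have h3 : ((n : ℝ) + 2) ^ 2 + 12 =
      (n : ℝ) ^ 2 * ((1 + 2 * (n : ℝ)⁻¹) ^ 2 + 12 * ((n : ℝ)⁻¹) ^ 2) := by
    field_simp
  rw [h3, Real.log_mul (by positivity) (by positivity), Real.log_pow] at h2
  push_cast at h2
  rw [lowC]
  push_cast at h h2 ⊢
  linarith

lemma lowC_tendsto : Filter.Tendsto lowC Filter.atTop (nhds (Real.log 12 / 2)) := by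
  have h := tendsto_inv_atTop_nhds_zero_nat (𝕜 := ℝ)
  have hc : ContinuousAt (fun v : ℝ =>
      Real.log 12 / 2 - Real.log ((1 + 2 * v) ^ 2 + 12 * v ^ 2) / 2) 0 := by
    apply ContinuousAt.sub continuousAt_const
    apply ContinuousAt.div_const
    apply ContinuousAt.log (by fun_prop) (by norm_num)
  have := hc.tendsto.comp h
  have e : Real.log 12 / 2 - Real.log ((1 + 2 * (0 : ℝ)) ^ 2 + 12 * 0 ^ 2) / 2 =
      Real.log 12 / 2 := by simp
  rw [e] at this
  exact this

lemma logSeq_mono (y : ℝ) (hy : 7 / 2 < y) (a b : ℝ) (ha : 0 < a) (hab : a ≤ b) (hb : b ≤ 1)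
    (n : ℕ) (hn : 0 < n) : lowC n * (b - a) ≤ logSeq y n b - logSeq y n a := by
  have hd := logSeq_hasDerivAt y (by linarith) n
  refine Convex.mul_sub_le_image_sub_of_le_deriv (convex_Icc a b)
    (fun x _ => (hd x).continuousAt.continuousWithinAt)
    (fun x _ => (hd x).differentiableAt.differentiableWithinAt) ?_ a
    (Set.left_mem_Icc.mpr hab) b (Set.right_mem_Icc.mpr hab) hab
  intro x hx
  rw [interior_Icc] at hx
  rw [(hd x).deriv]
  exact deriv_bound y hy x (ha.trans hx.1) (hx.2.le.trans hb) n hn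

lemma Gamma_ne (x y : ℝ) (hx : 0 < x) : Complex.Gamma (x + y * I) ≠ 0 :=
  Complex.Gamma_ne_zero_of_re_pos (by simpa using hx)

lemma logGamma_mono (y : ℝ) (hy : 7 / 2 < y) (a b : ℝ) (ha : 0 < a) (hab : a ≤ b) (hb : b ≤ 1) :
    Real.log 12 / 2 * (b - a) ≤
      Real.log ‖Complex.Gamma (b + y * I)‖ - Real.log ‖Complex.Gamma (a + y * I)‖ := by
  have ht : ∀ x : ℝ, 0 < x → Filter.Tendsto (fun n => logSeq y n x) Filter.atTop
      (nhds (Real.log ‖Complex.Gamma (x + y * I)‖)) := by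
    intro x hx
    have h := ((Complex.GammaSeq_tendsto_Gamma (x + y * I)).norm).log
      (norm_ne_zero_iff.mpr (Gamma_ne x y hx))
    refine h.congr' ?_
    filter_upwards [Filter.eventually_gt_atTop 0] with n hn
    exact logSeq_eq y (by linarith) n hn x
  refine le_of_tendsto_of_tendsto (lowC_tendsto.mul_const (b - a))
    ((ht b (ha.trans_le hab)).sub (ht a ha)) ?_
  filter_upwards [Filter.eventually_gt_atTop 0] with n hn
  exact logSeq_mono y hy a b ha hab hb n hn

lemma digamma_re_bound (y : ℝ) (hy : 7 / 2 < y) :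
    Real.log 12 / 2 ≤ (deriv Complex.Gamma ((1 / 4 : ℝ) + y * I) /
      Complex.Gamma ((1 / 4 : ℝ) + y * I)).re := by
  set a : ℝ := 1 / 4 with ha
  set z : ℂ := a + y * I with hz
  have hzre : z.re = a := by simp [hz]
  have hG : Complex.Gamma z ≠ 0 := Gamma_ne a y (by norm_num [ha])
  have hdiff : DifferentiableAt ℂ Complex.Gamma z := by
    apply Complex.differentiableAt_Gamma
    intro m h
    have := congrArg Complex.re h
    rw [hzre] at this
    simp [ha] at this
    have hm : (0 : ℝ) ≤ m := m.cast_nonneg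
    linarith
  have h2 : HasDerivAt (fun u : ℂ => u + y * I) 1 (a : ℂ) :=
    (hasDerivAt_id (a : ℂ)).add_const (y * I)
  have h3 : HasDerivAt (fun u : ℝ => Complex.Gamma (u + y * I)) (deriv Complex.Gamma z) a := by
    simpa using
      (HasDerivAt.comp (a : ℂ) (h₂ := Complex.Gamma) hdiff.hasDerivAt h2).comp_ofReal
  have h4 := h3.norm_sq.log (by simpa using hG)
  have h5 : HasDerivAt (fun u : ℝ => Real.log ‖Complex.Gamma (u + y * I)‖)
      (deriv Complex.Gamma z / Complex.Gamma z).re a := by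
    have e : (fun u : ℝ => Real.log ‖Complex.Gamma (u + y * I)‖) =
        fun u : ℝ => Real.log (‖Complex.Gamma (u + y * I)‖ ^ 2) / 2 := by
      ext u; rw [Real.log_pow]; push_cast; ring
    rw [e]
    refine (h4.div_const 2).congr_deriv ?_
    · rw [Complex.inner, Complex.div_re, ← Complex.normSq_eq_norm_sq]
      have : Complex.normSq (Complex.Gamma z) ≠ 0 := by simpa using hG
      rw [← hz]
      field_simp
      simp
      try ring
  have h6 := (hasDerivWithinAt_iff_tendsto_slope' (s := Set.Ioi a) (by simp)).mp
    (h5.hasDerivWithinAt)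
  refine ge_of_tendsto h6 ?_
  filter_upwards [Ioc_mem_nhdsGT (show a < 1 by norm_num [ha])] with b hb
  rw [slope_def_field, le_div_iff₀ (sub_pos.mpr hb.1)]
  exact logGamma_mono y hy a b (by norm_num [ha]) hb.1.le hb.2

lemma log_pi_lt : Real.log Real.pi < Real.log 12 / 2 := by
  have h : Real.log (Real.pi ^ 2) < Real.log 12 :=
    Real.log_lt_log (by positivity) (by nlinarith [Real.pi_lt_d2, Real.pi_pos])
  rw [Real.log_pow] at h
  push_cast at h
  linarith

theorem zeta_zero_iff_re_eta_zero (t : ℝ) (ht : 7 < t) :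
    riemannZeta (1 / 2 + t * I) = 0 ↔ (zhangEta (1 / 2 + t * I)).re = 0 := by
  have him := completed_im_zero t
  have hre0 := deriv_completed_re_zero t
  have hdig := digamma_re_bound (t / 2) (by linarith)
  have hz2 : (((1 / 4 : ℝ) : ℂ) + ((t / 2 : ℝ) : ℂ) * I) = (1 / 2 + t * I) / 2 := by
    push_cast; ring
  rw [hz2] at hdig
  set s : ℂ := 1 / 2 + t * I with hs
  have hre : s.re = 1 / 2 := by simp [hs]
  have hs0 : s ≠ 0 := fun h => by simp [h] at hre
  have hs1 : s ≠ 1 := fun h => by norm_num [h] at hre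
  have hGR : Gammaℝ s ≠ 0 := Gammaℝ_ne_zero_of_re_pos (by rw [hre]; norm_num)
  have hG : Complex.Gamma (s / 2) ≠ 0 :=
    Complex.Gamma_ne_zero_of_re_pos (by simp [hre])
  have hdiff : DifferentiableAt ℂ Complex.Gamma (s / 2) := by
    apply Complex.differentiableAt_Gamma
    intro m h
    have := congrArg Complex.re h
    simp [hre] at this
    have hm : (0 : ℝ) ≤ m := m.cast_nonneg
    linarith
  have hpi : (Real.pi : ℂ) ≠ 0 := by exact_mod_cast Real.pi_ne_zero
  set ψ : ℂ := deriv Complex.Gamma (s / 2) / Complex.Gamma (s / 2) with hψ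
  have hdG : HasDerivAt Gammaℝ (Gammaℝ s * ((ψ - Complex.log Real.pi) / 2)) s := by
    have h1 : HasDerivAt (fun w : ℂ => -w / 2) (-1 / 2) s :=
      ((hasDerivAt_id s).neg).div_const 2
    have h2 : HasDerivAt (fun w : ℂ => w / 2) (1 / 2) s := (hasDerivAt_id s).div_const 2
    have h3 := h1.const_cpow (c := (Real.pi : ℂ)) (Or.inl hpi)
    have h4 := HasDerivAt.comp s (h₂ := Complex.Gamma) hdiff.hasDerivAt h2
    refine (h3.mul h4).congr_deriv ?_
    rw [Gammaℝ_def, hψ]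
    simp only [Function.comp]
    field_simp
    ring
  have hL : HasDerivAt completedRiemannZeta
      (Gammaℝ s * ((ψ - Complex.log Real.pi) / 2) * riemannZeta s +
        Gammaℝ s * deriv riemannZeta s) s := by
    refine (hdG.mul (differentiableAt_riemannZeta hs1).hasDerivAt).congr_of_eventuallyEq ?_
    have hopen : ∀ᶠ w : ℂ in nhds s, 0 < w.re :=
      (isOpen_lt continuous_const Complex.continuous_re).mem_nhds
        (show 0 < s.re by rw [hre]; norm_num)
    filter_upwards [hopen] with w hw
    have hw0 : w ≠ 0 := fun h => by simp [h] at hw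
    have := Gammaℝ_ne_zero_of_re_pos hw
    simp only [Pi.mul_apply]
    rw [riemannZeta_def_of_ne_zero hw0]
    field_simp
  have heta : zhangEta s = Gammaℝ s * deriv riemannZeta s := by rw [zhangEta, Gammaℝ_def]
  have hLam : completedRiemannZeta s = Gammaℝ s * riemannZeta s := by
    rw [riemannZeta_def_of_ne_zero hs0]; field_simp
  have hmain : deriv completedRiemannZeta s =
      ((ψ - Complex.log Real.pi) / 2) * completedRiemannZeta s + zhangEta s := by
    rw [hL.deriv, heta, hLam]; ring
  have hk : 0 < (ψ - Complex.log Real.pi).re := by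
    have e : Complex.log Real.pi = (Real.log Real.pi : ℝ) := (Complex.ofReal_log Real.pi_pos.le).symm
    rw [e, Complex.sub_re, Complex.ofReal_re]
    linarith [log_pi_lt]
  have hr := congrArg Complex.re hmain
  rw [hre0, Complex.add_re, Complex.mul_re, him] at hr
  have e2 : ((ψ - Complex.log Real.pi) / 2).re = (ψ - Complex.log Real.pi).re / 2 := by simp
  rw [e2] at hr
  constructor
  · intro h
    have : completedRiemannZeta s = 0 := by rw [hLam, h, mul_zero]
    rw [this] at hr
    simpa using hr.symm
  · intro h
    have h0 : (ψ - Complex.log Real.pi).re / 2 * (completedRiemannZeta s).re = 0 := by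
      rw [h] at hr; linarith
    have h1 : (completedRiemannZeta s).re = 0 := by
      rcases mul_eq_zero.mp h0 with h' | h'
      · linarith
      · exact h'
    have h2 : completedRiemannZeta s = 0 := Complex.ext h1 him
    rw [hLam] at h2
    exact (mul_eq_zero.mp h2).resolve_left hGR
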